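/- Let γ1 = (m1, N1, a1) and γ2 = (m2, N2, a2) be monodromy data satisfying hypothesis (A), let γ3 = (m3, N3, a3) be the clutched datum, and let ε = d1·d2·r0 − d1 − d2 + 1. Then the genus values satisfy g(m3, N3, a3) = d1·g(m1, N1, a1) + d2·g(m2, N2, a2) + ε. -/

import Mathlib

/-- `(m, N, a)` is a monodromy datum. -/
def IsMonodromyDatum (m N : ℕ) (a : ℕ → ℤ) : Prop :=
  2 ≤ m ∧ 3 ≤ N ∧
  (∀ i ∈ Finset.Icc 1 N, ¬ (m : ℤ) ∣ a i) ∧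
  Nat.gcd m ((Finset.Icc 1 N).gcd fun i => (a i).natAbs) = 1 ∧
  (m : ℤ) ∣ ∑ i ∈ Finset.Icc 1 N, a i

/-- The genus `g(m, N, a) = 1 + ((N−2)·m − Σ gcd(a(i), m))/2`, as a rational number. -/
def genus (m N : ℕ) (a : ℕ → ℤ) : ℚ :=
  1 + (((N : ℚ) - 2) * (m : ℚ) - ∑ i ∈ Finset.Icc 1 N, (Int.gcd (a i) (m : ℤ) : ℚ)) / 2

theorem sum_Icc_one_eq_sum_range {M : Type*} [AddCommMonoid M] (f : ℕ → M) (n : ℕ) :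
    ∑ i ∈ Finset.Icc 1 n, f i = ∑ i ∈ Finset.range n, f (i + 1) := by
  induction n with
  | zero => simp
  | succ n ih => rw [Finset.sum_Icc_succ_top (by omega), Finset.sum_range_succ, ih]

theorem coprime_lcm_div {m n : ℕ} (hm : 0 < m) (hn : 0 < n) :
    Nat.Coprime (Nat.lcm m n / m) (Nat.lcm m n / n) := by
  have h := Nat.coprime_div_gcd_div_gcd (Nat.gcd_pos_of_pos_left n hm)
  have e1 : Nat.lcm m n / m = n / Nat.gcd m n := by
    rw [Nat.lcm, Nat.mul_div_assoc _ (Nat.gcd_dvd_right m n), Nat.mul_div_cancel_left _ hm]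
  have e2 : Nat.lcm m n / n = m / Nat.gcd m n := by
    rw [Nat.lcm, Nat.mul_comm, Nat.mul_div_assoc _ (Nat.gcd_dvd_left m n),
      Nat.mul_div_cancel_left _ hn]
  rw [e1, e2]
  exact h.symm

/-- If `d * r = e * s` with `d`, `e` coprime, then this common value is `d * e * gcd r s`. -/
theorem mul_eq_mul_mul_gcd_of_coprime {d e r s : ℕ} (hde : Nat.Coprime d e)
    (h : d * r = e * s) : d * r = d * e * Nat.gcd r s := by
  obtain ⟨k, rfl⟩ : e ∣ r := hde.symm.dvd_of_dvd_mul_left ⟨s, h⟩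
  rcases Nat.eq_zero_or_pos e with rfl | he
  · simp
  have hs : s = d * k := Nat.eq_of_mul_eq_mul_left he (by rw [← h]; ring)
  rw [hs, Nat.gcd_mul_right, hde.symm.gcd_eq_one]
  ring

/-- Integers whose sum is divisible by `m` have the same gcd with `m`. -/
theorem gcd_eq_gcd_of_dvd_add {m x y : ℤ} (h : m ∣ x + y) : Int.gcd x m = Int.gcd y m := by
  obtain ⟨k, hk⟩ := h
  obtain rfl : x = -y + m * k := by linarith
  simp

/-- The genus of the clutched datum satisfies `g3 = d1·g1 + d2·g2 + ε` with
`ε = d1·d2·r0 − d1 − d2 + 1`. -/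
theorem stmt2 (m1 N1 m2 N2 : ℕ) (a1 a2 : ℕ → ℤ)
    (h1 : IsMonodromyDatum m1 N1 a1) (h2 : IsMonodromyDatum m2 N2 a2)
    (m3 d1 d2 N3 : ℕ) (a3 : ℕ → ℤ)
    (hm3 : m3 = Nat.lcm m1 m2) (hd1 : d1 = m3 / m1) (hd2 : d2 = m3 / m2)
    (hA : (m3 : ℤ) ∣ (d1 : ℤ) * a1 N1 + (d2 : ℤ) * a2 1)
    (hN3 : N3 = N1 + N2 - 2)
    (ha3 : ∀ i, a3 i = if i ≤ N1 - 1 then (d1 : ℤ) * a1 i else (d2 : ℤ) * a2 (i - N1 + 2))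
    (r1 r2 r0 : ℕ) (hr1 : r1 = Int.gcd (m1 : ℤ) (a1 N1)) (hr2 : r2 = Int.gcd (m2 : ℤ) (a2 1))
    (hr0 : r0 = Nat.gcd r1 r2)
    (ε : ℚ) (hε : ε = (d1 : ℚ) * d2 * r0 - d1 - d2 + 1) :
    genus m3 N3 a3 = (d1 : ℚ) * genus m1 N1 a1 + (d2 : ℚ) * genus m2 N2 a2 + ε := by
  obtain ⟨hm1, hN1, -⟩ := h1
  obtain ⟨hm2, hN2, -⟩ := h2
  have e1 : m3 = d1 * m1 := by
    rw [hd1, Nat.div_mul_cancel (hm3 ▸ Nat.dvd_lcm_left m1 m2)]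
  have e2 : m3 = d2 * m2 := by
    rw [hd2, Nat.div_mul_cancel (hm3 ▸ Nat.dvd_lcm_right m1 m2)]
  have hcop : Nat.Coprime d1 d2 := by
    rw [hd1, hd2, hm3]
    exact coprime_lcm_div (by omega) (by omega)
  have g1 (x : ℤ) : Int.gcd (d1 * x) m3 = d1 * Int.gcd x m1 := by
    rw [e1, Nat.cast_mul, Int.gcd_mul_left, Int.natAbs_natCast]
  have g2 (x : ℤ) : Int.gcd (d2 * x) m3 = d2 * Int.gcd x m2 := by
    rw [e2, Nat.cast_mul, Int.gcd_mul_left, Int.natAbs_natCast]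
  rw [Int.gcd_comm] at hr1 hr2
  have hr : d1 * r1 = d2 * r2 := by
    rw [hr1, hr2, ← g1, ← g2]
    exact gcd_eq_gcd_of_dvd_add hA
  have hr' := mul_eq_mul_mul_gcd_of_coprime hcop hr
  rw [← hr0] at hr'
  have q1 : (d1 : ℚ) * r1 = d1 * d2 * r0 := mod_cast hr'
  have q2 : (d2 : ℚ) * r2 = d1 * d2 * r0 := mod_cast hr.symm.trans hr'
  have c1 : (m3 : ℚ) = d1 * m1 := mod_cast e1
  have c2 : (m3 : ℚ) = d2 * m2 := mod_cast e2
  obtain ⟨p, rfl⟩ : ∃ p, N1 = p + 1 := ⟨N1 - 1, by omega⟩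
  obtain ⟨q, rfl⟩ : ∃ q, N2 = q + 1 := ⟨N2 - 1, by omega⟩
  obtain rfl : N3 = p + q := by omega
  have s1 : ∑ i ∈ Finset.range p, (Int.gcd (a3 (i + 1)) m3 : ℚ) =
      d1 * ∑ i ∈ Finset.range p, (Int.gcd (a1 (i + 1)) m1 : ℚ) := by
    rw [Finset.mul_sum]
    refine Finset.sum_congr rfl fun i hi => ?_
    have := Finset.mem_range.1 hi
    rw [ha3, if_pos (by omega), g1, Nat.cast_mul]
  have s2 : ∑ i ∈ Finset.range q, (Int.gcd (a3 (p + i + 1)) m3 : ℚ) =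
      d2 * ∑ i ∈ Finset.range q, (Int.gcd (a2 (i + 1 + 1)) m2 : ℚ) := by
    rw [Finset.mul_sum]
    refine Finset.sum_congr rfl fun i _ => ?_
    rw [ha3, if_neg (by omega), g2, Nat.cast_mul,
      show p + i + 1 - (p + 1) + 2 = i + 1 + 1 by omega]
  simp only [genus, sum_Icc_one_eq_sum_range]
  rw [Finset.sum_range_add, s1, s2, Finset.sum_range_succ, Finset.sum_range_succ', ← hr1,
    zero_add, ← hr2, hε]
  push_cast
  linear_combination ((p : ℚ) - 1) / 2 * c1 + ((q : ℚ) - 1) / 2 * c2 + q1 / 2 + q2 / 2
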